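/- For every l ≥ 2, the function f₁ˡ belongs to the smallest composition-closed class of functions ℕ^k → ℕ (over all arities k) that contains all projections and, for every subset A ⊆ ℕ, the ternary function (m, n₁, n₂) ↦ if m ∈ A then n₁ else n₂; moreover, for every l ≥ 1, the function f₂ˡ also belongs to this class (indeed f₂ˡ(m, n₁, n₂) = if m ∈ {0, 1, …, l} then n₁ else n₂). -/

import Mathlib

open scoped Classical

/-- The smallest composition-closed class of functions `ℕ^k → ℕ` (over all
arities `k`) containing all projections and, for every subset `A ⊆ ℕ`, the
ternary function `(m, n₁, n₂) ↦ if m ∈ A then n₁ else n₂`. -/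
inductive CondClass : ∀ {k : ℕ}, ((Fin k → ℕ) → ℕ) → Prop
  | proj {k : ℕ} (i : Fin k) : CondClass (fun v => v i)
  | cond (A : Set ℕ) :
      CondClass (fun v : Fin 3 → ℕ => if v 0 ∈ A then v 1 else v 2)
  | comp {k m : ℕ} {f : (Fin k → ℕ) → ℕ} {g : Fin k → (Fin m → ℕ) → ℕ} :
      CondClass f → (∀ i, CondClass (g i)) →
      CondClass (fun v => f (fun i => g i v))

namespace CondClass

/-- A conditional on membership of a class member's value in a set stays in the class. -/
theorem ite_mem {k : ℕ} {a b c : (Fin k → ℕ) → ℕ} (A : Set ℕ) (ha : CondClass a)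
    (hb : CondClass b) (hc : CondClass c) :
    CondClass (fun v => if a v ∈ A then b v else c v) :=
  comp (g := ![a, b, c]) (cond A) fun i => by
    fin_cases i
    exacts [ha, hb, hc]

/-- Selecting among finitely many class members according to an arbitrary function `p` of the
value of a class member stays in the class. -/
theorem select_min {k : ℕ} {a : (Fin k → ℕ) → ℕ} {g : ℕ → (Fin k → ℕ) → ℕ} (p : ℕ → ℕ)
    (ha : CondClass a) (hg : ∀ i, CondClass (g i)) (n : ℕ) :
    CondClass (fun v => g (min (p (a v)) n) v) := by
  induction n with
  | zero => simpa using hg 0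
  | succ n ih =>
    convert ite_mem {m | p m ≤ n} ha ih (hg (n + 1)) using 2 with v
    split_ifs with h
    · have h' : p (a v) ≤ n := h
      rw [min_eq_left h', min_eq_left (h'.trans n.le_succ)]
    · have h' : ¬ p (a v) ≤ n := h
      rw [min_eq_right (by omega)]

end CondClass

/-- For every `l ≥ 2`, `f₁ˡ` belongs to the class generated by projections and
membership conditionals; for every `l ≥ 1`, `f₂ˡ` also belongs to this class
(indeed `f₂ˡ(m, n₁, n₂) = if m ∈ {0, 1, …, l} then n₁ else n₂`). -/
theorem f1_f2_mem_condClass :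
    (∀ l : ℕ, ∀ hl : 2 ≤ l,
      CondClass (fun v : Fin (l + 1) → ℕ =>
        v ⟨v 0 % l + 1, Nat.succ_lt_succ (Nat.mod_lt _ (by omega))⟩)) ∧
    (∀ l : ℕ, 1 ≤ l →
      CondClass (fun v : Fin 3 → ℕ => if v 0 ≤ l then v 1 else v 2) ∧
      (fun v : Fin 3 → ℕ => if v 0 ≤ l then v 1 else v 2) =
        (fun v : Fin 3 → ℕ => if v 0 ∈ Set.Iic l then v 1 else v 2)) := by
  refine ⟨fun l hl => ?_, fun l _ => ⟨?_, by simp only [Set.mem_Iic]⟩⟩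
  · convert CondClass.select_min (g := fun i v => v (Fin.ofNat (l + 1) (i + 1))) (· % l)
      (CondClass.proj 0) (fun _ => CondClass.proj _) l using 3 with v
    have h : v 0 % l < l := Nat.mod_lt _ (by omega)
    ext
    simp [min_eq_left h.le, Nat.mod_eq_of_lt (Nat.succ_lt_succ h)]
  · simpa only [Set.mem_Iic] using CondClass.cond (Set.Iic l)
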